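/- Let C ↠ B be an A-Galois coextension with cotranslation map τ̌ := (ε ⊗ A) ∘ cocan^{-1} : C □_B C → A. Then: (i) τ̌ ∘ Δ = η ∘ ε on C; (ii) μ_C ∘ (C ⊗ τ̌) ∘ (Δ ⊗ C) = ε ⊗ C on C □_B C; (iii) τ̌ ∘ (C ⊗ μ_C) = m ∘ (τ̌ ⊗ A) on (C □_B C) ⊗ A. -/

import Mathlib

open TensorProduct LinearMap Coalgebra

variable {k A C : Type*} [Field k] [Ring A] [Algebra k A]
  [AddCommGroup C] [Module k C] [Coalgebra k C]

/-- `μ : C ⊗ A → C` is a unital, associative right `A`-action on `C`. -/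
def IsAction (μ : C ⊗[k] A →ₗ[k] C) : Prop :=
  (∀ c : C, μ (c ⊗ₜ[k] (1 : A)) = c)
  ∧ (∀ (c : C) (a a' : A), μ (μ (c ⊗ₜ[k] a) ⊗ₜ[k] a') = μ (c ⊗ₜ[k] (a * a')))

/-- Action by a fixed element `a ∈ A`: `c ↦ μ(c ⊗ a)`. -/
noncomputable def actBy (μ : C ⊗[k] A →ₗ[k] C) (a : A) : C →ₗ[k] C :=
  μ ∘ₗ (TensorProduct.mk k C A).flip a

/-- The subspace `I` of Lemma 3.2: the span of all
`μ(c,a)₍₁₎ α(μ(c,a)₍₂₎) − c₍₁₎ α(μ(c₍₂₎,a))` for `a ∈ A`, `c ∈ C`, `α ∈ Hom(C,k)`. -/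
noncomputable def coidealI (μ : C ⊗[k] A →ₗ[k] C) : Submodule k C :=
  Submodule.span k {x : C | ∃ (a : A) (c : C) (α : C →ₗ[k] k), x =
    TensorProduct.rid k C (α.lTensor C (comul (R := k) (μ (c ⊗ₜ[k] a))))
      - TensorProduct.rid k C ((α ∘ₗ actBy μ a).lTensor C (comul (R := k) c))}

/-- `(π ⊗ C) ∘ Δ : C → B ⊗ C`, where `B = C / I` and `π` the quotient map. -/
noncomputable def coactL (μ : C ⊗[k] A →ₗ[k] C) :
    C →ₗ[k] (C ⧸ coidealI μ) ⊗[k] C :=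
  (coidealI μ).mkQ.rTensor C ∘ₗ comul (R := k)

/-- `(C ⊗ π) ∘ Δ : C → C ⊗ B`. -/
noncomputable def coactR (μ : C ⊗[k] A →ₗ[k] C) :
    C →ₗ[k] C ⊗[k] (C ⧸ coidealI μ) :=
  (coidealI μ).mkQ.lTensor C ∘ₗ comul (R := k)

/-- The coaction-equalising map `C ⊗ C → C ⊗ B ⊗ C` whose kernel is the
cotensor product `C □_B C`. -/
noncomputable def cotensorEq (μ : C ⊗[k] A →ₗ[k] C) :
    C ⊗[k] C →ₗ[k] C ⊗[k] ((C ⧸ coidealI μ) ⊗[k] C) :=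
  ((TensorProduct.assoc k C (C ⧸ coidealI μ) C).toLinearMap ∘ₗ (coactR μ).rTensor C)
    - (coactL μ).lTensor C

/-- The cotensor product `C □_B C ⊆ C ⊗ C`. -/
noncomputable def cotensor (μ : C ⊗[k] A →ₗ[k] C) : Submodule k (C ⊗[k] C) :=
  LinearMap.ker (cotensorEq μ)

/-- The canonical map `cocan = (C ⊗ μ) ∘ (Δ ⊗ A) : C ⊗ A → C ⊗ C`
(taking values in `C □_B C`). -/
noncomputable def cocanF (μ : C ⊗[k] A →ₗ[k] C) : C ⊗[k] A →ₗ[k] C ⊗[k] C :=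
  μ.lTensor C ∘ₗ (TensorProduct.assoc k C C A).toLinearMap
    ∘ₗ (comul (R := k) (A := C)).rTensor A

/-- `σ` is an inverse of `cocan` regarded as a map onto `C □_B C`, i.e. the
coextension `C ↠ B` is `A`-Galois. -/
def IsCocanInverse (μ : C ⊗[k] A →ₗ[k] C) (σ : C ⊗[k] C →ₗ[k] C ⊗[k] A) : Prop :=
  (LinearMap.range (cocanF μ) ≤ cotensor μ)
  ∧ (σ ∘ₗ cocanF μ = LinearMap.id)
  ∧ (∀ x ∈ cotensor μ, cocanF μ (σ x) = x)

/-- The cotranslation map `τ̌ = (ε ⊗ A) ∘ cocan⁻¹ : C □_B C → A`, expressed via a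
linear extension `σ` of `cocan⁻¹`. -/
noncomputable def cotrans (σ : C ⊗[k] C →ₗ[k] C ⊗[k] A) : C ⊗[k] C →ₗ[k] A :=
  (TensorProduct.lid k A).toLinearMap ∘ₗ (counit (R := k) (A := C)).rTensor A ∘ₗ σ

theorem cocanF_tmul (μ : C ⊗[k] A →ₗ[k] C) (c : C) (a : A) :
    cocanF μ (c ⊗ₜ[k] a) = (actBy μ a).lTensor C (comul (R := k) c) := by
  simp only [cocanF, LinearMap.comp_apply, rTensor_tmul, LinearEquiv.coe_coe]
  induction comul (R := k) c using TensorProduct.induction_on with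
  | zero => simp
  | add x y hx hy => rw [add_tmul, map_add, map_add, map_add, hx, hy]
  | tmul x y => simp [actBy]

theorem cotrans_cocanF (μ : C ⊗[k] A →ₗ[k] C) (σ : C ⊗[k] C →ₗ[k] C ⊗[k] A)
    (h : σ ∘ₗ cocanF μ = LinearMap.id) (c : C) (a : A) :
    cotrans σ (cocanF μ (c ⊗ₜ[k] a)) = counit (R := k) c • a := by
  have hc : σ (cocanF μ (c ⊗ₜ[k] a)) = c ⊗ₜ[k] a := LinearMap.congr_fun h _
  simp [cotrans, hc]

theorem assoc_comul_rTensor_lTensor_comul (f : C →ₗ[k] C) (c : C) :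
    TensorProduct.assoc k C C C ((comul (R := k) (A := C)).rTensor C
        (f.lTensor C (comul (R := k) c)))
      = (f.lTensor C ∘ₗ comul (R := k)).lTensor C (comul (R := k) c) := by
  rw [lTensor_comp, LinearMap.comp_apply, ← coassoc_apply]
  induction comul (R := k) c using TensorProduct.induction_on with
  | zero => simp
  | add x y hx hy => simp only [map_add, hx, hy]
  | tmul x y =>
    simp only [lTensor_tmul, rTensor_tmul]
    induction comul (R := k) x using TensorProduct.induction_on with
    | zero => simp
    | add x y hx hy => simp only [add_tmul, map_add, hx, hy]
    | tmul x z => simp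

theorem actBy_lTensor_cocanF (μ : C ⊗[k] A →ₗ[k] C) (hμ : IsAction μ) (c : C) (a b : A) :
    (actBy μ a).lTensor C (cocanF μ (c ⊗ₜ[k] b)) = cocanF μ (c ⊗ₜ[k] (b * a)) := by
  have h : actBy μ a ∘ₗ actBy μ b = actBy μ (b * a) := by
    ext c
    exact hμ.2 c b a
  rw [cocanF_tmul, cocanF_tmul, ← LinearMap.comp_apply, ← lTensor_comp, h]

/-- properties (i)–(iii) of the cotranslation map
`τ̌ = (ε ⊗ A) ∘ cocan⁻¹` of an `A`-Galois coextension. -/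
theorem cotranslation_properties (μ : C ⊗[k] A →ₗ[k] C) (hμ : IsAction μ)
    (σ : C ⊗[k] C →ₗ[k] C ⊗[k] A) (hσ : IsCocanInverse μ σ) :
    (∀ c : C, cotrans σ (comul (R := k) c) = algebraMap k A (counit (R := k) c))
    ∧ (∀ x ∈ cotensor μ,
        μ ((cotrans σ).lTensor C ((TensorProduct.assoc k C C C)
            ((comul (R := k) (A := C)).rTensor C x)))
          = TensorProduct.lid k C ((counit (R := k) (A := C)).rTensor C x))
    ∧ (∀ x ∈ cotensor μ, ∀ a : A,
        cotrans σ ((actBy μ a).lTensor C x) = cotrans σ x * a) := by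
  obtain ⟨-, hl, hr⟩ := hσ
  refine ⟨fun c => ?_, fun x hx => ?_, fun x hx a => ?_⟩
  · have h1 : actBy μ (1 : A) = LinearMap.id := by
      ext c
      exact hμ.1 c
    have h := cotrans_cocanF μ σ hl c 1
    rwa [cocanF_tmul, h1, lTensor_id, LinearMap.id_apply, ← Algebra.algebraMap_eq_smul_one] at h
  · rw [← hr x hx]
    induction σ x using TensorProduct.induction_on with
    | zero => simp
    | add y z hy hz => simp only [map_add, hy, hz]
    | tmul c a =>
      have h : cotrans σ ∘ₗ (actBy μ a).lTensor C ∘ₗ comul (R := k)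
          = LinearMap.toSpanSingleton k A a ∘ₗ counit (R := k) := by
        ext d
        simpa [cocanF_tmul] using cotrans_cocanF μ σ hl d a
      rw [cocanF_tmul, assoc_comul_rTensor_lTensor_comul, ← LinearMap.comp_apply (lTensor C _),
        ← lTensor_comp, h, lTensor_comp, LinearMap.comp_apply, lTensor_counit_comul,
        ← LinearMap.comp_apply (rTensor C _), rTensor_comp_lTensor, ← lTensor_comp_rTensor,
        LinearMap.comp_apply, rTensor_counit_comul]
      simp [actBy]
  · rw [← hr x hx]
    induction σ x using TensorProduct.induction_on with
    | zero => simp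
    | add y z hy hz => simp only [map_add, add_mul, hy, hz]
    | tmul c b =>
      rw [actBy_lTensor_cocanF μ hμ, cotrans_cocanF μ σ hl, cotrans_cocanF μ σ hl, smul_mul_assoc]
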